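/- Fix an integer l ≥ 2. For every d ∈ ℤ^{ℤ/lℤ} there exists a unique l-core λ such that Res_l(λ) − d is an integer multiple of δ_l. In other words, the map sending an l-core λ to the class of Res_l(λ) in ℤ^{ℤ/lℤ}/ℤδ_l is a bijection from the set of l-cores onto ℤ^{ℤ/lℤ}/ℤδ_l. -/

import Mathlib

/-- The `l`-residue of a box `(r, s)` of a Young diagram (0-based row `r`, column `s`):
the class of `s - r` in `ℤ/lℤ`. -/
def boxRes (l : ℕ) (c : ℕ × ℕ) : ZMod l := (c.2 : ZMod l) - (c.1 : ZMod l)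

/-- `Res_l(λ) ∈ ℤ^{ℤ/lℤ}`: the function counting the boxes of `λ` with each `l`-residue. -/
def Res (l : ℕ) (lam : YoungDiagram) : ZMod l → ℤ :=
  fun i => ((lam.cells.filter fun c => boxRes l c = i).card : ℤ)

/-- `λ` is an `l`-core: there is no Young diagram `μ ≤ λ` obtained from `λ` by removing
exactly `l` boxes having pairwise distinct `l`-residues. -/
def IsCore (l : ℕ) (lam : YoungDiagram) : Prop :=
  ¬ ∃ mu : YoungDiagram, mu ≤ lam ∧ (lam.cells \ mu.cells).card = l ∧
      Set.InjOn (boxRes l) ↑(lam.cells \ mu.cells)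

/-- The content `s - r` of a box in row `r` and column `s`. -/
def content (c : ℕ × ℕ) : ℤ := (c.2 : ℤ) - (c.1 : ℤ)

theorem boxRes_eq_cast_content (l : ℕ) (c : ℕ × ℕ) : boxRes l c = ((content c : ℤ) : ZMod l) := by
  simp [boxRes, content]

/-- The bead indicator at position `k` of the Maya diagram whose diagonal lengths are `D`. -/
def bead (D : ℤ → ℤ) (k : ℤ) : ℤ := D k - D (k + 1) + if k < 0 then 1 else 0

/-- The functions `ℤ → ℤ` which arise as diagonal lengths of Young diagrams. -/
structure IsDiagonal (D : ℤ → ℤ) : Prop where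
  finite_support : D.support.Finite
  bead_nonneg : ∀ k, 0 ≤ bead D k
  bead_le_one : ∀ k, bead D k ≤ 1

theorem exists_forall_natAbs_eq_zero {D : ℤ → ℤ} (hD : D.support.Finite) :
    ∃ N : ℕ, ∀ k : ℤ, N ≤ k.natAbs → D k = 0 := by
  obtain ⟨N, hN⟩ := (hD.image Int.natAbs).bddAbove
  refine ⟨N + 1, fun k hk => ?_⟩
  by_contra h
  have := hN ⟨k, h, rfl⟩
  omega

theorem IsDiagonal.nonneg {D : ℤ → ℤ} (hD : IsDiagonal D) (k : ℤ) : 0 ≤ D k := by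
  obtain ⟨N, hN⟩ := exists_forall_natAbs_eq_zero hD.finite_support
  rcases le_or_gt 0 k with hk | hk
  · have h : ∀ n : ℕ, D (k + n) ≤ D k := by
      intro n
      induction n with
      | zero => simp
      | succ n ih =>
        have := hD.bead_nonneg (k + n)
        rw [bead, if_neg (by omega), add_assoc] at this
        push_cast
        linarith
    have := h N
    rwa [hN _ (by omega)] at this
  · have h : ∀ n : ℕ, D (k - n) ≤ D k := by
      intro n
      induction n with
      | zero => simp
      | succ n ih =>
        have := hD.bead_le_one (k - (n + 1))
        rw [bead, if_pos (by omega), show k - ((n : ℤ) + 1) + 1 = k - n by ring] at this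
        push_cast
        linarith
    have := h N
    rwa [hN _ (by omega)] at this

/-- The number of boxes of content `k`. -/
def diagonal (lam : YoungDiagram) (k : ℤ) : ℤ :=
  ((lam.cells.filter fun c => content c = k).card : ℤ)

theorem Finset.mem_iff_lt_card_of_isLowerSet {s : Finset ℕ} (hs : IsLowerSet (s : Set ℕ)) (m : ℕ) :
    m ∈ s ↔ m < s.card := by
  constructor
  · intro hm
    have : Finset.range (m + 1) ⊆ s := fun i hi =>
      hs (Nat.lt_succ_iff.1 (Finset.mem_range.1 hi)) hm
    simpa using Finset.card_le_card this
  · intro hm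
    by_contra h
    have : s ⊆ Finset.range m := fun i hi => by
      by_contra h'
      exact h (hs (by simpa using h') hi)
    have := Finset.card_le_card this
    rw [Finset.card_range] at this
    omega

theorem mem_iff_min_lt_diagonal (lam : YoungDiagram) (c : ℕ × ℕ) :
    c ∈ lam ↔ (min c.1 c.2 : ℤ) < diagonal lam (content c) := by
  set k := content c with hk
  set F := lam.cells.filter fun c => content c = k with hF
  have hinj : Set.InjOn (fun c : ℕ × ℕ => min c.1 c.2) F := by
    intro a ha b hb hab
    have ha' := (Finset.mem_filter.1 (Finset.mem_coe.1 ha)).2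
    have hb' := (Finset.mem_filter.1 (Finset.mem_coe.1 hb)).2
    rw [← hb'] at ha'
    simp only [content] at ha' hab
    ext <;> omega
  have hlow : IsLowerSet ((F.image fun c : ℕ × ℕ => min c.1 c.2 : Finset ℕ) : Set ℕ) := by
    intro a b hab ha
    simp only [hF, Finset.coe_image, Set.mem_image, Finset.mem_coe, Finset.mem_filter,
      YoungDiagram.mem_cells] at ha ⊢
    obtain ⟨x, ⟨hx, hxk⟩, rfl⟩ := ha
    refine ⟨(b + (x.1 - min x.1 x.2), b + (x.2 - min x.1 x.2)),
      ⟨lam.up_left_mem (i2 := x.1) (j2 := x.2) (by omega) (by omega) hx, ?_⟩, ?_⟩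
    · simp only [content] at hxk ⊢
      omega
    · dsimp only
      omega
  have key := Finset.mem_iff_lt_card_of_isLowerSet hlow (min c.1 c.2)
  rw [Finset.card_image_of_injOn hinj] at key
  rw [diagonal, ← hF]
  have hc : c ∈ lam ↔ min c.1 c.2 ∈ F.image fun c : ℕ × ℕ => min c.1 c.2 := by
    constructor
    · intro h
      exact Finset.mem_image_of_mem _ (Finset.mem_filter.2 ⟨h, rfl⟩)
    · intro h
      obtain ⟨x, hx, hxc⟩ := Finset.mem_image.1 h
      obtain ⟨hx, hxk⟩ := Finset.mem_filter.1 hx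
      have : x = c := by
        simp only [hk, content] at hxk
        ext <;> omega
      exact this ▸ hx
  rw [hc, key]
  omega

theorem diagonal_injective : Function.Injective diagonal := by
  intro lam mu h
  ext c
  rw [YoungDiagram.mem_cells, YoungDiagram.mem_cells, mem_iff_min_lt_diagonal, h,
    ← mem_iff_min_lt_diagonal]

theorem le_of_diagonal_le {mu lam : YoungDiagram} (h : ∀ k, diagonal mu k ≤ diagonal lam k) :
    mu ≤ lam := by
  intro c hc
  rw [mem_iff_min_lt_diagonal] at hc ⊢
  exact hc.trans_le (h _)

/-- The box of content `k` at position `m` of its diagonal. -/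
def diagonalBox (k : ℤ) (m : ℕ) : ℕ × ℕ := (m + (-k).toNat, m + k.toNat)

theorem content_diagonalBox (k : ℤ) (m : ℕ) : content (diagonalBox k m) = k := by
  simp only [content, diagonalBox]
  omega

theorem min_diagonalBox (k : ℤ) (m : ℕ) :
    (min (diagonalBox k m).1 (diagonalBox k m).2 : ℤ) = m := by
  simp only [diagonalBox]
  omega

theorem diagonalBox_content_min (c : ℕ × ℕ) : diagonalBox (content c) (min c.1 c.2) = c := by
  simp only [diagonalBox, content]
  ext <;> dsimp only <;> omega

theorem diagonalBox_mem_iff (lam : YoungDiagram) (k : ℤ) (m : ℕ) :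
    diagonalBox k m ∈ lam ↔ (m : ℤ) < diagonal lam k := by
  rw [mem_iff_min_lt_diagonal, min_diagonalBox, content_diagonalBox]

theorem diagonal_nonneg (lam : YoungDiagram) (k : ℤ) : 0 ≤ diagonal lam k := Nat.cast_nonneg _

theorem diagonal_le_of_imp {lam : YoungDiagram} {k k' : ℤ} {a : ℕ}
    (h : ∀ m : ℕ, diagonalBox k (m + a) ∈ lam → diagonalBox k' m ∈ lam) :
    diagonal lam k ≤ diagonal lam k' + a := by
  by_contra! hlt
  have h0 := diagonal_nonneg lam k'
  have := h (diagonal lam k').toNat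
  rw [diagonalBox_mem_iff, diagonalBox_mem_iff] at this
  omega

theorem support_diagonal_subset (lam : YoungDiagram) :
    (diagonal lam).support ⊆ (lam.cells.image content : Finset ℤ) := by
  intro k hk
  rw [Function.mem_support, diagonal, Nat.cast_ne_zero, Finset.card_ne_zero] at hk
  obtain ⟨c, hc⟩ := hk
  exact Finset.mem_coe.2 (Finset.mem_image.2 ⟨c, Finset.mem_filter.1 hc⟩)

theorem isDiagonal_diagonal (lam : YoungDiagram) : IsDiagonal (diagonal lam) := by
  have hle : ∀ (k k' : ℤ) (a : ℕ), (-k').toNat ≤ a + (-k).toNat → k'.toNat ≤ a + k.toNat →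
      diagonal lam k ≤ diagonal lam k' + a := fun k k' a h₁ h₂ =>
    diagonal_le_of_imp fun m hm => lam.up_left_mem (by omega) (by omega) hm
  refine ⟨?_, fun k => ?_, fun k => ?_⟩
  · exact (lam.cells.image content).finite_toSet.subset (support_diagonal_subset lam)
  · rw [bead]
    split_ifs with hk
    · have := hle (k + 1) k 1 (by omega) (by omega)
      push_cast at this
      linarith
    · have := hle (k + 1) k 0 (by omega) (by omega)
      push_cast at this
      linarith
  · rw [bead]
    split_ifs with hk
    · have := hle k (k + 1) 0 (by omega) (by omega)
      push_cast at this
      linarith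
    · have := hle k (k + 1) 1 (by omega) (by omega)
      push_cast at this
      linarith

theorem IsDiagonal.exists_diagonal_eq {D : ℤ → ℤ} (hD : IsDiagonal D) :
    ∃ lam : YoungDiagram, diagonal lam = D := by
  let s : Finset (ℕ × ℕ) := hD.finite_support.toFinset.biUnion fun k =>
    (Finset.range (D k).toNat).image (diagonalBox k)
  have hs : ∀ c, c ∈ s ↔ (min c.1 c.2 : ℤ) < D (content c) := by
    intro c
    simp only [s, Finset.mem_biUnion, Set.Finite.mem_toFinset, Finset.mem_image, Finset.mem_range,
      Function.mem_support]
    constructor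
    · rintro ⟨k, -, m, hm, rfl⟩
      rw [content_diagonalBox, min_diagonalBox]
      omega
    · intro h
      exact ⟨content c, by omega, min c.1 c.2, by omega, diagonalBox_content_min c⟩
  have hrow : ∀ r t : ℕ, (r, t + 1) ∈ s → (r, t) ∈ s := by
    intro r t h
    rw [hs] at h ⊢
    have h₁ := hD.bead_nonneg (content (r, t))
    have h₂ : content (r, t + 1) = content (r, t) + 1 := by simp only [content]; push_cast; ring
    rw [h₂] at h
    unfold bead at h₁
    split_ifs at h₁ with hc <;> simp only [content] at * <;> push_cast at * <;> omega
  have hcol : ∀ r t : ℕ, (r + 1, t) ∈ s → (r, t) ∈ s := by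
    intro r t h
    rw [hs] at h ⊢
    have h₁ := hD.bead_le_one (content (r + 1, t))
    have h₂ : content (r, t) = content (r + 1, t) + 1 := by simp only [content]; push_cast; ring
    rw [h₂]
    unfold bead at h₁
    split_ifs at h₁ with hc <;> simp only [content] at * <;> push_cast at * <;> omega
  have hlow : IsLowerSet (s : Set (ℕ × ℕ)) := by
    rintro ⟨a, b⟩ ⟨a', b'⟩ ⟨h₁, h₂⟩ h
    obtain ⟨i, rfl⟩ := Nat.exists_eq_add_of_le (show a' ≤ a from h₁)
    obtain ⟨j, rfl⟩ := Nat.exists_eq_add_of_le (show b' ≤ b from h₂)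
    simp only [Finset.mem_coe] at h ⊢
    clear h₁ h₂
    induction i with
    | zero =>
      induction j with
      | zero => exact h
      | succ j ih => exact ih (hrow _ _ h)
    | succ i ih => exact ih (hcol _ _ h)
  refine ⟨⟨s, hlow⟩, funext fun k => ?_⟩
  have h : ∀ m : ℕ, (m : ℤ) < diagonal ⟨s, hlow⟩ k ↔ (m : ℤ) < D k := fun m => by
    rw [← diagonalBox_mem_iff, YoungDiagram.mem_mk, hs, min_diagonalBox, content_diagonalBox]
  have h₁ := hD.nonneg k
  have h₂ := diagonal_nonneg ⟨s, hlow⟩ k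
  have h₃ := h (D k).toNat
  have h₄ := h (diagonal ⟨s, hlow⟩ k).toNat
  omega

theorem not_isCore_of_bead {l : ℕ} (hl : 0 < l) {lam : YoungDiagram} {k : ℤ}
    (hk : bead (diagonal lam) k = 1) (hkl : bead (diagonal lam) (k - l) = 0) : ¬ IsCore l lam := by
  have hlam := isDiagonal_diagonal lam
  set D := diagonal lam with hD
  let D' : ℤ → ℤ := fun j => D j - if k - l < j ∧ j ≤ k then 1 else 0
  have hbead : ∀ j, bead D' j =
      bead D j + (if j = k - l then 1 else 0) - (if j = k then 1 else 0) := by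
    intro j
    simp only [bead, D']
    split_ifs <;> omega
  have hD' : IsDiagonal D' := by
    refine ⟨?_, fun j => ?_, fun j => ?_⟩
    · refine (hlam.finite_support.union (Finset.Ioc (k - l) k).finite_toSet).subset fun j hj => ?_
      by_contra h
      simp only [Set.mem_union, Function.mem_support, Finset.mem_coe, Finset.mem_Ioc, not_or,
        not_not] at h
      exact hj (by simp only [D', h.1, if_neg h.2, sub_zero])
    · have h₁ := hlam.bead_nonneg j
      rw [hbead]
      split_ifs with h₂ h₃ h₃ <;> subst_vars <;> omega
    · have h₁ := hlam.bead_le_one j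
      rw [hbead]
      split_ifs with h₂ h₃ h₃ <;> subst_vars <;> omega
  obtain ⟨mu, hmu⟩ := hD'.exists_diagonal_eq
  have hdiff : ∀ c, c ∈ lam.cells \ mu.cells ↔
      (k - l < content c ∧ content c ≤ k) ∧ (min c.1 c.2 : ℤ) = D' (content c) := by
    intro c
    rw [Finset.mem_sdiff, YoungDiagram.mem_cells, YoungDiagram.mem_cells, mem_iff_min_lt_diagonal,
      mem_iff_min_lt_diagonal, hmu, ← hD]
    have h := hD'.nonneg (content c)
    simp only [D']
    split_ifs <;> omega
  have heq : ∀ c ∈ lam.cells \ mu.cells, diagonalBox (content c) (D' (content c)).toNat = c := by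
    intro c hc
    conv_rhs => rw [← diagonalBox_content_min c]
    rw [← ((hdiff c).1 hc).2]
    congr 1
    omega
  rw [IsCore, not_not]
  refine ⟨mu, le_of_diagonal_le fun j => ?_, ?_, ?_⟩
  · rw [hmu, ← hD]
    simp only [D']
    split_ifs <;> omega
  · have himg : lam.cells \ mu.cells =
        (Finset.Ioc (k - l) k).image fun j => diagonalBox j (D' j).toNat := by
      ext c
      rw [Finset.mem_image]
      constructor
      · intro hc
        exact ⟨content c, Finset.mem_Ioc.2 ((hdiff c).1 hc).1, heq c hc⟩
      · rintro ⟨j, hj, rfl⟩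
        rw [hdiff, content_diagonalBox, min_diagonalBox]
        exact ⟨Finset.mem_Ioc.1 hj, Int.toNat_of_nonneg (hD'.nonneg j)⟩
    rw [himg, Finset.card_image_of_injective, Int.card_Ioc]
    · omega
    · intro i j hij
      simpa only [content_diagonalBox] using congrArg content hij
  · intro a ha b hb hab
    have ha' := ((hdiff a).1 ha).1
    have hb' := ((hdiff b).1 hb).1
    rw [boxRes_eq_cast_content, boxRes_eq_cast_content, ZMod.intCast_eq_intCast_iff_dvd_sub] at hab
    have h0 := Int.eq_zero_of_abs_lt_dvd hab (abs_lt.2 ⟨by omega, by omega⟩)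
    rw [← heq a ha, ← heq b hb, show content a = content b by omega]

theorem IsCore.bead_sub_mul {l : ℕ} (hl : 0 < l) {lam : YoungDiagram} (h : IsCore l lam) {k : ℤ}
    (hk : bead (diagonal lam) k = 1) (n : ℕ) : bead (diagonal lam) (k - l * n) = 1 := by
  induction n with
  | zero => simpa using hk
  | succ n ih =>
    have h₁ := (isDiagonal_diagonal lam).bead_nonneg (k - l * n - l)
    have h₂ := (isDiagonal_diagonal lam).bead_le_one (k - l * n - l)
    have h₃ : bead (diagonal lam) (k - l * n - l) ≠ 0 := fun h₀ =>
      not_isCore_of_bead hl ih h₀ h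
    rw [show k - l * ((n + 1 : ℕ) : ℤ) = k - l * n - l by push_cast; ring]
    omega

theorem IsCore.bead_eq_one_of_le {l : ℕ} (hl : 0 < l) {lam : YoungDiagram} (h : IsCore l lam)
    {j k : ℤ} (hk : bead (diagonal lam) k = 1) (hjk : j ≤ k) (hres : (j : ZMod l) = k) :
    bead (diagonal lam) j = 1 := by
  obtain ⟨q, hq⟩ := (ZMod.intCast_eq_intCast_iff_dvd_sub _ _ _).1 hres
  have hq0 : 0 ≤ q := by
    by_contra! hq0
    have : (l : ℤ) * q < 0 := mul_neg_of_pos_of_neg (by omega) hq0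
    omega
  have := h.bead_sub_mul hl hk q.toNat
  rwa [Int.toNat_of_nonneg hq0, ← hq, sub_sub_cancel] at this

/-- The sum of the values of `g` over the integers in the residue class `i`. -/
noncomputable def residueSum (l : ℕ) (g : ℤ → ℤ) (i : ZMod l) : ℤ :=
  ∑ᶠ k : ℤ, if (k : ZMod l) = i then g k else 0

theorem finite_support_residue {l : ℕ} {g : ℤ → ℤ} (hg : g.support.Finite) (i : ZMod l) :
    (Function.support fun k : ℤ => if (k : ZMod l) = i then g k else 0).Finite :=
  hg.subset fun k hk => by
    rw [Function.mem_support] at hk ⊢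
    exact fun h => hk (by simp [h])

theorem finite_support_comp_add_one {g : ℤ → ℤ} (hg : g.support.Finite) :
    (Function.support fun k => g (k + 1)).Finite :=
  hg.preimage (f := fun k : ℤ => k + 1) fun a _ b _ h => by simpa using h

theorem residueSum_sub {l : ℕ} {f g : ℤ → ℤ} (hf : f.support.Finite) (hg : g.support.Finite)
    (i : ZMod l) :
    residueSum l (fun k => f k - g k) i = residueSum l f i - residueSum l g i := by
  rw [residueSum, residueSum, residueSum,
    ← finsum_sub_distrib (finite_support_residue hf i) (finite_support_residue hg i)]
  refine finsum_congr fun k => ?_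
  split_ifs <;> simp

theorem residueSum_comp_add_one (l : ℕ) (g : ℤ → ℤ) (i : ZMod l) :
    residueSum l (fun k => g (k + 1)) i = residueSum l g (i + 1) := by
  rw [residueSum, residueSum, ← finsum_comp_equiv (Equiv.addRight (1 : ℤ))
    (f := fun k : ℤ => if (k : ZMod l) = i + 1 then g k else 0)]
  refine finsum_congr fun k => ?_
  simp

theorem residueSum_sub_succ {l : ℕ} {g : ℤ → ℤ} (hg : g.support.Finite) (i : ZMod l) :
    residueSum l (fun k => g k - g (k + 1)) i = residueSum l g i - residueSum l g (i + 1) := by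
  rw [residueSum_sub hg (finite_support_comp_add_one hg), residueSum_comp_add_one]

theorem Res_eq_residueSum (l : ℕ) (lam : YoungDiagram) (i : ZMod l) :
    Res l lam i = residueSum l (diagonal lam) i := by
  have hsub : (Function.support fun k : ℤ => if (k : ZMod l) = i then diagonal lam k else 0) ⊆
      (lam.cells.image content : Finset ℤ) := fun k hk => by
    exact support_diagonal_subset lam fun h => hk (by simp [h])
  rw [residueSum, finsum_eq_sum_of_support_subset _ hsub, Res,
    Finset.card_eq_sum_card_fiberwise (f := content) (t := lam.cells.image content), Nat.cast_sum]
  · refine Finset.sum_congr rfl fun k _ => ?_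
    rw [Finset.filter_filter, diagonal]
    split_ifs with h
    · congr 2
      refine Finset.filter_congr fun c _ => ?_
      rw [boxRes_eq_cast_content]
      exact ⟨fun h' => h'.2, fun h' => ⟨h' ▸ h, h'⟩⟩
    · rw [Nat.cast_eq_zero, Finset.card_eq_zero, Finset.filter_eq_empty_iff]
      rintro c - ⟨h₁, h₂⟩
      rw [boxRes_eq_cast_content, h₂] at h₁
      exact h h₁
  · intro c hc
    exact Finset.mem_coe.2 (Finset.mem_image_of_mem _ (Finset.mem_filter.1 hc).1)

theorem eq_zero_of_residueSum_eq_zero {l : ℕ} {g : ℤ → ℤ} (hg : g.support.Finite) {i : ZMod l}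
    (h : residueSum l g i = 0) (hnonneg : ∀ k : ℤ, (k : ZMod l) = i → 0 ≤ g k) {k : ℤ}
    (hk : (k : ZMod l) = i) : g k = 0 := by
  have hfin := finite_support_residue hg i
  have hterm : ∀ k : ℤ, 0 ≤ if (k : ZMod l) = i then g k else 0 := fun k => by
    split_ifs with hk
    exacts [hnonneg k hk, le_rfl]
  rw [residueSum, finsum_eq_sum _ hfin, Finset.sum_eq_zero_iff_of_nonneg fun k _ => hterm k] at h
  by_contra hne
  have := h k (by simp [hk, hne])
  rw [if_pos hk] at this
  exact hne this

theorem eq_of_finite_support_of_sub_succ {f g : ℤ → ℤ} (hf : f.support.Finite)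
    (hg : g.support.Finite) (h : ∀ k, f k - f (k + 1) = g k - g (k + 1)) : f = g := by
  obtain ⟨N, hN⟩ := exists_forall_natAbs_eq_zero hf
  obtain ⟨M, hM⟩ := exists_forall_natAbs_eq_zero hg
  have hshift : ∀ (k : ℤ) (n : ℕ), f k - g k = f (k + n) - g (k + n) := by
    intro k n
    induction n with
    | zero => simp
    | succ n ih =>
      have := h (k + n)
      push_cast
      rw [← add_assoc]
      linarith
  funext k
  have := hshift k (N + M + k.natAbs)
  rw [hN (k + _) (by omega), hM (k + _) (by omega)] at this
  linarith

theorem IsCore.eq_of_Res_sub {l : ℕ} (hl : 0 < l) {lam mu : YoungDiagram} (hlam : IsCore l lam)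
    (hmu : IsCore l mu) {c : ℤ} (h : ∀ i, Res l lam i - Res l mu i = c) : lam = mu := by
  have hDl := isDiagonal_diagonal lam
  have hDm := isDiagonal_diagonal mu
  let g : ℤ → ℤ := fun k => diagonal lam k - diagonal mu k
  have hg : g.support.Finite :=
    (hDl.finite_support.union hDm.finite_support).subset (Function.support_sub _ _)
  have hg' : (Function.support fun k => g k - g (k + 1)).Finite :=
    (hg.union (finite_support_comp_add_one hg)).subset (Function.support_sub _ _)
  have hbead : ∀ k, g k - g (k + 1) = bead (diagonal lam) k - bead (diagonal mu) k := fun k => by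
    simp only [g, bead]
    ring
  have hsum : ∀ i : ZMod l, residueSum l (fun k => g k - g (k + 1)) i = 0 := fun i => by
    have hRes : ∀ i : ZMod l, residueSum l g i = c := fun i => by
      rw [← h i, Res_eq_residueSum, Res_eq_residueSum,
        ← residueSum_sub hDl.finite_support hDm.finite_support]
    rw [residueSum_sub_succ hg, hRes, hRes, sub_self]
  refine diagonal_injective
    (eq_of_finite_support_of_sub_succ hDl.finite_support hDm.finite_support fun k => ?_)
  suffices hz : g k - g (k + 1) = 0 by
    simp only [g] at hz
    linarith
  by_cases hpos : ∀ j : ℤ, (j : ZMod l) = k → 0 ≤ g j - g (j + 1)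
  · exact eq_zero_of_residueSum_eq_zero hg' (hsum k) hpos rfl
  · push Not at hpos
    obtain ⟨j, hjk, hj⟩ := hpos
    have hneg : ∀ m : ℤ, (m : ZMod l) = k → 0 ≤ -(g m - g (m + 1)) := by
      intro m hmk
      rw [hbead] at hj ⊢
      by_contra! hm
      have hj₁ := hDl.bead_nonneg j
      have hj₂ := hDm.bead_le_one j
      have hm₁ := hDl.bead_le_one m
      have hm₂ := hDm.bead_nonneg m
      rcases le_total j m with hjm | hjm
      · have := hlam.bead_eq_one_of_le hl (by omega) hjm (hjk.trans hmk.symm)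
        omega
      · have := hmu.bead_eq_one_of_le hl (by omega) hjm (hmk.trans hjk.symm)
        omega
    have hsum' : residueSum l (fun k => -(g k - g (k + 1))) (k : ZMod l) = 0 := by
      have := residueSum_sub (f := fun _ => 0) (by simp) hg' (k : ZMod l)
      rw [hsum] at this
      simpa [residueSum] using this
    have hsupp : (Function.support fun k => -(g k - g (k + 1))).Finite :=
      hg'.subset fun k hk h => hk (neg_eq_zero.2 h)
    have := eq_zero_of_residueSum_eq_zero hsupp hsum' hneg (k := k) rfl
    linarith

/-- The difference between the Maya diagram with runner `i` filled exactly below level `c i`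
and the Maya diagram of the empty partition. -/
def runnerDiff (l : ℕ) (c : ZMod l → ℤ) (k : ℤ) : ℤ :=
  (if k / l < c k then 1 else 0) - if k / l < 0 then 1 else 0

theorem sum_Ico_indicator_sub {C c : ℤ} (hc : |c| ≤ C) :
    ∑ q ∈ Finset.Ico (-C) C, ((if q < c then 1 else 0) - if q < 0 then 1 else 0 : ℤ) = c := by
  obtain ⟨h₁, h₂⟩ := abs_le.1 hc
  have h : ∀ a : ℤ, a ≤ C → (Finset.Ico (-C) C).filter (· < a) = Finset.Ico (-C) a := by
    intro a ha
    ext q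
    simp only [Finset.mem_filter, Finset.mem_Ico]
    omega
  rw [Finset.sum_sub_distrib, Finset.sum_boole, Finset.sum_boole, h c h₂, h 0 (by omega),
    Int.card_Ico, Int.card_Ico]
  omega

theorem sum_runnerDiff {l : ℕ} [NeZero l] {c : ZMod l → ℤ} {C : ℤ} (hc : ∀ i, |c i| ≤ C)
    (i : ZMod l) :
    ∑ k ∈ (Finset.Ico (-(l * C)) (l * C)).filter (fun k : ℤ => (k : ZMod l) = i),
      runnerDiff l c k = c i := by
  have hl : (0 : ℤ) < l := by exact_mod_cast NeZero.pos l
  have hi : (i.val : ℤ) < l := by exact_mod_cast i.val_lt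
  have hdiv : ∀ q : ℤ, ((i.val : ℤ) + l * q) / l = q := fun q => by
    rw [Int.add_mul_ediv_left _ _ hl.ne', Int.ediv_eq_zero_of_lt (by positivity) hi, zero_add]
  have hcast : ∀ q : ℤ, (((i.val : ℤ) + l * q : ℤ) : ZMod l) = i := fun q => by simp
  rw [← sum_Ico_indicator_sub (hc i)]
  symm
  refine Finset.sum_bij (fun q _ => (i.val : ℤ) + l * q) ?_ ?_ ?_ ?_
  · intro q hq
    rw [Finset.mem_Ico] at hq
    rw [Finset.mem_filter, Finset.mem_Ico]
    refine ⟨⟨?_, ?_⟩, hcast q⟩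
    · nlinarith [hq.1, Int.natCast_nonneg i.val]
    · nlinarith [hq.2]
  · intro a _ b _ hab
    rw [← hdiv a, ← hdiv b, hab]
  · intro k hk
    rw [Finset.mem_filter, Finset.mem_Ico] at hk
    obtain ⟨⟨h₁, h₂⟩, hki⟩ := hk
    refine ⟨k / l, Finset.mem_Ico.2 ⟨?_, ?_⟩, ?_⟩
    · rw [Int.le_ediv_iff_mul_le hl]
      linarith
    · rw [Int.ediv_lt_iff_lt_mul hl]
      linarith
    · rw [← hki, ZMod.val_intCast]
      exact Int.emod_add_mul_ediv k l
  · intro q _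
    rw [runnerDiff, hdiv, hcast]

theorem exists_Res_sub_succ_eq {l : ℕ} [NeZero l] {c : ZMod l → ℤ}
    (hc : ∑ i, c i = 0) :
    ∃ lam : YoungDiagram, ∀ i, Res l lam i - Res l lam (i + 1) = c i := by
  have hl : (0 : ℤ) < l := by exact_mod_cast NeZero.pos l
  set C : ℤ := ∑ i, |c i|
  have hC : ∀ i, |c i| ≤ C := fun i =>
    Finset.single_le_sum (f := fun i => |c i|) (fun _ _ => abs_nonneg _) (Finset.mem_univ i)
  set N : ℤ := l * C with hN
  have hlt : ∀ {k}, k < -N → runnerDiff l c k = 0 := by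
    intro k hk
    have h : k / l < -C := by
      rw [Int.ediv_lt_iff_lt_mul hl]
      linarith
    have := abs_le.1 (hC k)
    rw [runnerDiff, if_pos (by omega), if_pos (by omega), sub_self]
  have hge : ∀ {k}, N ≤ k → runnerDiff l c k = 0 := by
    intro k hk
    have h : C ≤ k / l := by
      rw [Int.le_ediv_iff_mul_le hl]
      linarith
    have := abs_le.1 (hC k)
    rw [runnerDiff, if_neg (by omega), if_neg (by omega), sub_self]
  have htotal : ∑ k ∈ Finset.Ico (-N) N, runnerDiff l c k = 0 := by
    rw [← Finset.sum_fiberwise (Finset.Ico (-N) N) (fun k : ℤ => (k : ZMod l)), ← hc]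
    exact Finset.sum_congr rfl fun i _ => sum_runnerDiff hC i
  let D : ℤ → ℤ := fun k => ∑ j ∈ Finset.Ico k N, runnerDiff l c j
  have hstep : ∀ k, D k - D (k + 1) = runnerDiff l c k := by
    intro k
    rcases lt_or_ge k N with hk | hk
    · simp only [D]
      rw [← Finset.insert_Ico_add_one_left_eq_Ico hk, Finset.sum_insert (by simp),
        add_sub_cancel_right]
    · simp only [D]
      rw [hge hk, Finset.Ico_eq_empty (by omega), Finset.Ico_eq_empty (by omega), sub_self]
  have hD : D.support.Finite := by
    refine (Finset.Ico (-N) N).finite_toSet.subset fun k hk => ?_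
    rw [Finset.mem_coe, Finset.mem_Ico]
    by_contra h
    apply hk
    rcases le_or_gt N k with hk | hk
    · simp only [D]
      rw [Finset.Ico_eq_empty (by omega), Finset.sum_empty]
    · simp only [D]
      rw [← htotal]
      symm
      refine Finset.sum_subset (Finset.Ico_subset_Ico_left (by omega)) fun j _ hj => hlt ?_
      simp only [Finset.mem_Ico] at *
      omega
  have hbead : ∀ k, bead D k = if k / l < c k then 1 else 0 := by
    intro k
    have : k / l < 0 ↔ k < 0 := by
      rw [Int.ediv_lt_iff_lt_mul hl, zero_mul]
    rw [bead, hstep, runnerDiff]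
    simp only [this, sub_add_cancel]
  obtain ⟨lam, hlam⟩ := IsDiagonal.exists_diagonal_eq (D := D)
    ⟨hD, fun k => by rw [hbead]; split_ifs <;> omega, fun k => by rw [hbead]; split_ifs <;> omega⟩
  refine ⟨lam, fun i => ?_⟩
  rw [Res_eq_residueSum, Res_eq_residueSum, hlam, ← residueSum_sub_succ hD, residueSum,
    ← sum_runnerDiff hC i, Finset.sum_filter]
  simp only [hstep]
  refine finsum_eq_sum_of_support_subset _ fun k hk => ?_
  rw [Finset.mem_coe, Finset.mem_Ico]
  by_contra h
  apply hk
  have : runnerDiff l c k = 0 := by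
    rcases le_or_gt N k with hk | hk
    exacts [hge hk, hlt (by omega)]
  simp [this]

theorem ZMod.eq_of_forall_add_one {l : ℕ} [NeZero l] {f : ZMod l → ℤ}
    (h : ∀ i, f (i + 1) = f i) (i : ZMod l) : f i = f 0 := by
  have hn : ∀ n : ℕ, f (n : ZMod l) = f 0 := by
    intro n
    induction n with
    | zero => simp
    | succ n ih => rw [Nat.cast_succ, h, ih]
  rw [← ZMod.natCast_zmod_val i, hn]

theorem exists_Res_sub_eq {l : ℕ} [NeZero l] (d : ZMod l → ℤ) :
    ∃ lam : YoungDiagram, ∃ c : ℤ, ∀ i, Res l lam i - d i = c := by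
  obtain ⟨lam, hlam⟩ := exists_Res_sub_succ_eq (c := fun i => d i - d (i + 1)) <| by
    rw [Finset.sum_sub_distrib, sub_eq_zero]
    exact (Equiv.sum_comp (Equiv.addRight (1 : ZMod l)) d).symm
  refine ⟨lam, Res l lam 0 - d 0, ZMod.eq_of_forall_add_one (f := fun i => Res l lam i - d i) ?_⟩
  intro i
  have := hlam i
  linarith

theorem Res_eq_add_one_of_sdiff {l : ℕ} [NeZero l] {lam mu : YoungDiagram} (hle : mu ≤ lam)
    (hcard : (lam.cells \ mu.cells).card = l)
    (hinj : Set.InjOn (boxRes l) ↑(lam.cells \ mu.cells)) (i : ZMod l) :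
    Res l lam i = Res l mu i + 1 := by
  have hsub : mu.cells ⊆ lam.cells := YoungDiagram.cells_subset_iff.2 hle
  have huniv : (lam.cells \ mu.cells).image (boxRes l) = Finset.univ := by
    rw [← Finset.card_eq_iff_eq_univ, Finset.card_image_of_injOn hinj, hcard, ZMod.card]
  obtain ⟨c, hc, hci⟩ := Finset.mem_image.1 (huniv ▸ Finset.mem_univ i)
  have hone : (lam.cells \ mu.cells).filter (fun c => boxRes l c = i) = {c} := by
    ext x
    rw [Finset.mem_filter, Finset.mem_singleton]
    constructor
    · rintro ⟨hx, hxi⟩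
      exact hinj hx hc (hxi.trans hci.symm)
    · rintro rfl
      exact ⟨hc, hci⟩
  rw [Res, Res, ← Finset.sdiff_union_of_subset hsub, Finset.filter_union,
    Finset.card_union_of_disjoint (Finset.disjoint_filter_filter Finset.sdiff_disjoint), hone,
    Finset.card_singleton]
  push_cast
  ring

/-- For every `d ∈ ℤ^{ℤ/lℤ}` there is a unique `l`-core `λ` such that `Res_l(λ) - d` is an
integer multiple of the constant function `δ_l = 1`; i.e. `λ ↦ Res_l(λ) mod ℤδ_l` is a
bijection from `l`-cores onto `ℤ^{ℤ/lℤ}/ℤδ_l`. -/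
theorem existsUnique_core_res_mod_delta (l : ℕ) (hl : 2 ≤ l) (d : ZMod l → ℤ) :
    ∃! lam : YoungDiagram, IsCore l lam ∧ ∃ c : ℤ, ∀ i : ZMod l, Res l lam i - d i = c := by
  have hl0 : 0 < l := by omega
  have : NeZero l := ⟨hl0.ne'⟩
  obtain ⟨lam, ⟨c, hc⟩, hmin⟩ := exists_minimalFor_of_wellFoundedLT
    (fun lam : YoungDiagram => ∃ c : ℤ, ∀ i, Res l lam i - d i = c) (fun lam => lam.cells.card)
    (exists_Res_sub_eq d)
  have hlam : IsCore l lam := by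
    rintro ⟨mu, hle, hcard, hinj⟩
    have hmu : ∃ c : ℤ, ∀ i, Res l mu i - d i = c := ⟨c - 1, fun i => by
      rw [← hc i, Res_eq_add_one_of_sdiff hle hcard hinj]
      ring⟩
    have hsub : mu.cells ⊆ lam.cells := YoungDiagram.cells_subset_iff.2 hle
    have h₁ := Finset.card_sdiff_add_card_eq_card hsub
    have h₂ := hmin hmu (Finset.card_le_card hsub)
    dsimp only at h₂
    omega
  refine ⟨lam, ⟨hlam, c, hc⟩, ?_⟩
  rintro mu ⟨hmu, c', hc'⟩
  refine hmu.eq_of_Res_sub hl0 hlam (c := c' - c) fun i => ?_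
  rw [← hc i, ← hc' i]
  ring
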